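/- Let q ∈ ℝ with 0 < q < 1 and set r_k = q^{k/2}/√(1−q) for k ∈ ℕ. Let f(z) = Σ_n f_n z^n and g(z) = Σ_n g_n z^n be power series converging on the disk |z| < 1/(1−q) with Σ_n [n]_q! |f_n|² < ∞ and Σ_n [n]_q! |g_n|² < ∞. Then (q;q)_∞ · Σ_{k=0}^∞ (q^k/(q;q)_k) · (1/(2π)) ∫_0^{2π} f(r_k e^{iθ}) · conj(g(r_k e^{iθ})) dθ = Σ_{n=0}^∞ [n]_q! · f_n · conj(g_n), with all series and integrals involved converging absolutely. -/

import Mathlib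

open Finset Complex MeasureTheory

/-- q-bracket `[n]_q = 1 + q + ⋯ + q^(n-1)` (real version). -/
noncomputable def qBracket (q : ℝ) (n : ℕ) : ℝ := ∑ j ∈ Finset.range n, q ^ j

/-- q-factorial `[n]_q! = [1]_q [2]_q ⋯ [n]_q`, with `[0]_q! = 1`. -/
noncomputable def qFact (q : ℝ) (n : ℕ) : ℝ := ∏ i ∈ Finset.range n, qBracket q (i + 1)

/-- The finite q-Pochhammer symbol `(q;q)_k = ∏_{j=1}^k (1 - q^j)`, with `(q;q)_0 = 1`. -/
noncomputable def qPoch (q : ℝ) (k : ℕ) : ℝ := ∏ j ∈ Finset.Icc 1 k, (1 - q ^ j)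

/-- The radii `r_k = q^(k/2)/√(1−q)`. -/
noncomputable def rk (q : ℝ) (k : ℕ) : ℝ := q ^ ((k : ℝ) / 2) / Real.sqrt (1 - q)

lemma hs_mul (a b : ℕ → ℂ) (x y : ℂ) (hA : HasSum a x) (hB : HasSum b y)
    (hs : Summable fun p : ℕ × ℕ => a p.1 * b p.2) :
    HasSum (fun p : ℕ × ℕ => a p.1 * b p.2) (x * y) := HasSum.mul hA hB hs

lemma sm_mul (a b : ℕ → ℂ) (ha : Summable fun n => ‖a n‖) (hb : Summable fun n => ‖b n‖) :
    Summable fun p : ℕ × ℕ => ‖a p.1 * b p.2‖ := ha.mul_norm hb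

lemma hs_real {f g : ℕ → ℝ} {a b : ℝ} (h : HasSum f a) (hf : ∀ n, g n = f n) (hab : b = a) :
    HasSum g b := by
  rw [hab, funext hf]; exact h

lemma hs_complex {f g : ℕ → ℂ} {a b : ℂ} (h : HasSum f a) (hf : ∀ n, g n = f n) (hab : b = a) :
    HasSum g b := by
  rw [hab, funext hf]; exact h

lemma aux_integral (n m : ℕ) :
    ∫ θ in (0:ℝ)..(2 * Real.pi), Complex.exp (θ * Complex.I) ^ n *
      (starRingEnd ℂ) (Complex.exp (θ * Complex.I) ^ m) = if n = m then (2 * Real.pi : ℂ) else 0 := by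
  have key : ∀ θ : ℝ, Complex.exp (θ * Complex.I) ^ n *
      (starRingEnd ℂ) (Complex.exp (θ * Complex.I) ^ m)
      = Complex.exp ((((n : ℂ) - m) * Complex.I) * θ) := by
    intro θ
    rw [map_pow, ← Complex.exp_conj, ← Complex.exp_nat_mul, ← Complex.exp_nat_mul, ← Complex.exp_add]
    congr 1
    simp
    ring
  simp_rw [key]
  split_ifs with h
  · subst h; simp
  · have hne : ((n : ℂ) - m) * Complex.I ≠ 0 := by
      refine mul_ne_zero ?_ Complex.I_ne_zero
      rw [sub_ne_zero]; exact_mod_cast h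
    rw [integral_exp_mul_complex hne]
    have : Complex.exp (((n : ℂ) - m) * Complex.I * ((2 * Real.pi : ℝ) : ℂ)) = 1 := by
      rw [Complex.exp_eq_one_iff]
      exact ⟨(n : ℤ) - m, by push_cast; ring⟩
    rw [this]; simp

lemma aux_norm_exp (θ : ℝ) (n : ℕ) : ‖Complex.exp (θ * Complex.I) ^ n‖ = 1 := by
  rw [norm_pow, Complex.norm_exp_ofReal_mul_I, one_pow]

lemma aux_cont (a : ℕ → ℂ) (ha : Summable fun n => ‖a n‖) (A : ℝ → ℂ)
    (hA : ∀ θ : ℝ, HasSum (fun n => a n * Complex.exp (θ * Complex.I) ^ n) (A θ)) :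
    Continuous A := by
  have : A = fun θ : ℝ => ∑' n, a n * Complex.exp (θ * Complex.I) ^ n :=
    funext fun θ => (hA θ).tsum_eq.symm
  rw [this]
  refine continuous_tsum (fun n => by fun_prop) ha (fun n θ => ?_)
  rw [norm_mul, aux_norm_exp, mul_one]

lemma aux_pointwise (a b : ℕ → ℂ)
    (hS : Summable fun p : ℕ × ℕ => ‖a p.1 * (starRingEnd ℂ) (b p.2)‖) (e x y : ℂ)
    (he : ∀ n : ℕ, ‖e ^ n‖ = 1)
    (hA : HasSum (fun n => a n * e ^ n) x) (hB : HasSum (fun n => b n * e ^ n) y) :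
    HasSum (fun p : ℕ × ℕ => a p.1 * (starRingEnd ℂ) (b p.2) *
      (e ^ p.1 * (starRingEnd ℂ) (e ^ p.2))) (x * (starRingEnd ℂ) y) := by
  have hB' : HasSum (fun n => (starRingEnd ℂ) (b n * e ^ n)) ((starRingEnd ℂ) y) :=
    hB.map (starRingEnd ℂ) Complex.continuous_conj
  have e1 : (fun p : ℕ × ℕ => a p.1 * (starRingEnd ℂ) (b p.2) *
      (e ^ p.1 * (starRingEnd ℂ) (e ^ p.2)))
      = fun p : ℕ × ℕ => (a p.1 * e ^ p.1) * ((starRingEnd ℂ) (b p.2 * e ^ p.2)) := by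
    funext p
    rw [map_mul]; ring
  have hs : Summable fun p : ℕ × ℕ => (a p.1 * e ^ p.1) *
      ((starRingEnd ℂ) (b p.2 * e ^ p.2)) := by
    apply Summable.of_norm
    refine hS.congr fun p => ?_
    rw [norm_mul, norm_mul, norm_mul, RCLike.norm_conj, RCLike.norm_conj, norm_mul, he, he,
      mul_one, mul_one]
  rw [e1]
  exact hs_mul (fun n => a n * e ^ n) (fun n => (starRingEnd ℂ) (b n * e ^ n)) _ _ hA hB' hs

lemma aux_double (a b : ℕ → ℂ)
    (hS : Summable fun p : ℕ × ℕ => ‖a p.1 * (starRingEnd ℂ) (b p.2)‖)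
    (A B : ℝ → ℂ)
    (hA : ∀ θ : ℝ, HasSum (fun n => a n * Complex.exp (θ * Complex.I) ^ n) (A θ))
    (hB : ∀ θ : ℝ, HasSum (fun n => b n * Complex.exp (θ * Complex.I) ^ n) (B θ)) :
    HasSum (fun p : ℕ × ℕ => a p.1 * (starRingEnd ℂ) (b p.2) *
        (if p.1 = p.2 then (2 * Real.pi : ℂ) else 0))
      (∫ θ in (0 : ℝ)..(2 * Real.pi), A θ * (starRingEnd ℂ) (B θ)) := by
  have e : (fun p : ℕ × ℕ => a p.1 * (starRingEnd ℂ) (b p.2) *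
        (if p.1 = p.2 then (2 * Real.pi : ℂ) else 0)) =
      fun p : ℕ × ℕ => ∫ θ in (0 : ℝ)..(2 * Real.pi), a p.1 * (starRingEnd ℂ) (b p.2) *
      (Complex.exp (θ * Complex.I) ^ p.1 * (starRingEnd ℂ) (Complex.exp (θ * Complex.I) ^ p.2)) := by
    funext p
    rw [intervalIntegral.integral_const_mul, aux_integral]
  rw [e]
  apply intervalIntegral.hasSum_integral_of_dominated_convergence
    (fun p _ => ‖a p.1 * (starRingEnd ℂ) (b p.2)‖)
  · intro p
    apply Continuous.aestronglyMeasurable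
    exact continuous_const.mul ((by fun_prop : Continuous fun θ : ℝ =>
      Complex.exp (θ * Complex.I) ^ p.1).mul (Complex.continuous_conj.comp
        (by fun_prop : Continuous fun θ : ℝ => Complex.exp (θ * Complex.I) ^ p.2)))
  · intro p
    refine Filter.Eventually.of_forall fun θ _ => le_of_eq ?_
    rw [norm_mul, norm_mul (Complex.exp _ ^ _), RCLike.norm_conj, aux_norm_exp, aux_norm_exp,
      mul_one, mul_one]
  · exact Filter.Eventually.of_forall fun θ _ => hS
  · exact continuous_const.intervalIntegrable _ _
  · exact Filter.Eventually.of_forall fun θ _ =>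
      aux_pointwise a b hS _ _ _ (aux_norm_exp θ) (hA θ) (hB θ)

lemma aux_circle (a b : ℕ → ℂ) (ha : Summable fun n => ‖a n‖) (hb : Summable fun n => ‖b n‖)
    (A B : ℝ → ℂ)
    (hA : ∀ θ : ℝ, HasSum (fun n => a n * Complex.exp (θ * Complex.I) ^ n) (A θ))
    (hB : ∀ θ : ℝ, HasSum (fun n => b n * Complex.exp (θ * Complex.I) ^ n) (B θ)) :
    HasSum (fun n => a n * (starRingEnd ℂ) (b n))
      ((1 / (2 * Real.pi) : ℂ) * ∫ θ in (0 : ℝ)..(2 * Real.pi), A θ * (starRingEnd ℂ) (B θ)) := by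
  have hb' : Summable fun n => ‖(starRingEnd ℂ) (b n)‖ := by
    simpa only [RCLike.norm_conj] using hb
  have hS : Summable fun p : ℕ × ℕ => ‖a p.1 * (starRingEnd ℂ) (b p.2)‖ := 
    sm_mul a (fun n => (starRingEnd ℂ) (b n)) ha hb'
  have h2 := (aux_double a b hS A B hA hB).mul_left (1 / (2 * Real.pi) : ℂ)
  have hinj : Function.Injective (fun n : ℕ => (n, n)) := fun x y h => (Prod.mk.inj h).1
  rw [← hinj.hasSum_iff] at h2
  · have hpi : (Real.pi : ℂ) ≠ 0 := by exact_mod_cast Real.pi_ne_zero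
    refine hs_complex h2 (fun n => ?_) rfl
    simp only [Function.comp, if_true]
    field_simp
  · rintro ⟨x, y⟩ h
    have : x ≠ y := by rintro rfl; exact h ⟨x, rfl⟩
    simp only [if_neg this, mul_zero]

lemma qPoch_succ (q : ℝ) (k : ℕ) : qPoch q (k + 1) = qPoch q k * (1 - q ^ (k + 1)) := by
  unfold qPoch
  rw [Finset.prod_Icc_succ_top (by omega)]

lemma qPoch_range (q : ℝ) (k : ℕ) : qPoch q k = ∏ j ∈ Finset.range k, (1 - q ^ (j + 1)) := by
  induction k with
  | zero => simp [qPoch]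
  | succ k ih => rw [qPoch_succ, ih, Finset.prod_range_succ]

lemma qPoch_pos (q : ℝ) (hq0 : 0 < q) (hq1 : q < 1) (k : ℕ) : 0 < qPoch q k := by
  rw [qPoch_range]
  exact Finset.prod_pos fun j _ => sub_pos.2 (pow_lt_one₀ hq0.le hq1 (by omega))

lemma qFact_eq (q : ℝ) (hq1 : q < 1) (n : ℕ) : qFact q n = qPoch q n / (1 - q) ^ n := by
  have h : 1 - q ≠ 0 := by linarith
  induction n with
  | zero => simp [qFact, qPoch]
  | succ n ih =>
    have e : qFact q (n + 1) = qFact q n * qBracket q (n + 1) := by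
      unfold qFact; rw [Finset.prod_range_succ]
    have e2 : qBracket q (n + 1) * (1 - q) = 1 - q ^ (n + 1) := geom_sum_mul_neg q (n + 1)
    rw [e, ih, qPoch_succ, ← e2, pow_succ]
    field_simp

lemma qS_summable (q : ℝ) (hq0 : 0 < q) (hq1 : q < 1) (n : ℕ) :
    Summable fun k : ℕ => q ^ k / qPoch q k * q ^ (k * n) := by
  have h0 : Summable fun k : ℕ => q ^ k / qPoch q k := by
    apply summable_of_ratio_test_tendsto_lt_one hq1
    · exact Filter.Eventually.of_forall fun k =>
        (div_pos (pow_pos hq0 k) (qPoch_pos q hq0 hq1 k)).ne'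
    · have e : ∀ k : ℕ, ‖q ^ (k + 1) / qPoch q (k + 1)‖ / ‖q ^ k / qPoch q k‖
          = q / (1 - q ^ (k + 1)) := by
        intro k
        have h1 := qPoch_pos q hq0 hq1 k
        have h2 := qPoch_pos q hq0 hq1 (k + 1)
        have h3 : 0 < 1 - q ^ (k + 1) := sub_pos.2 (pow_lt_one₀ hq0.le hq1 (by omega))
        rw [Real.norm_of_nonneg (by positivity), Real.norm_of_nonneg (by positivity), qPoch_succ]
        field_simp
        ring
      simp_rw [e]
      have t := (tendsto_pow_atTop_nhds_zero_of_lt_one hq0.le hq1).comp (Filter.tendsto_add_atTop_nat 1)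
      have := (tendsto_const_nhds (x := q)).div ((tendsto_const_nhds (x := (1:ℝ))).sub t) (by simp)
      rw [sub_zero, div_one] at this
      exact this
  refine Summable.of_nonneg_of_le (fun k => ?_) (fun k => ?_) h0
  · have := qPoch_pos q hq0 hq1 k; positivity
  · have := qPoch_pos q hq0 hq1 k
    exact mul_le_of_le_one_right (by positivity) (pow_le_one₀ hq0.le hq1.le)

lemma qS_succ (q : ℝ) (hq0 : 0 < q) (hq1 : q < 1) (n : ℕ) :
    ∑' k : ℕ, q ^ k / qPoch q k * q ^ (k * (n + 1))
      = (1 - q ^ (n + 1)) * ∑' k : ℕ, q ^ k / qPoch q k * q ^ (k * n) := by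
  have s1 := qS_summable q hq0 hq1 n
  have s2 := qS_summable q hq0 hq1 (n + 1)
  have : ∑' k : ℕ, (q ^ k / qPoch q k * q ^ (k * n) - q ^ k / qPoch q k * q ^ (k * (n + 1)))
      = q ^ (n + 1) * ∑' k : ℕ, q ^ k / qPoch q k * q ^ (k * n) := by
    rw [(s1.sub s2).tsum_eq_zero_add, ← tsum_mul_left]
    simp only [pow_zero, zero_mul, sub_self, zero_add]
    refine tsum_congr fun k => ?_
    have h1 := qPoch_pos q hq0 hq1 k
    have h3 : 0 < 1 - q ^ (k + 1) := sub_pos.2 (pow_lt_one₀ hq0.le hq1 (by omega))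
    rw [qPoch_succ]
    field_simp
    ring
  rw [s1.tsum_sub s2] at this
  linarith

lemma qS_eq (q : ℝ) (hq0 : 0 < q) (hq1 : q < 1) (n : ℕ) :
    ∑' k : ℕ, q ^ k / qPoch q k * q ^ (k * n)
      = qPoch q n * ∑' k : ℕ, q ^ k / qPoch q k := by
  induction n with
  | zero => simp [qPoch]
  | succ n ih => rw [qS_succ q hq0 hq1, ih, qPoch_succ]; ring

lemma qS_limit (q : ℝ) (hq0 : 0 < q) (hq1 : q < 1) :
    Filter.Tendsto (fun n : ℕ => ∑' k : ℕ, q ^ k / qPoch q k * q ^ (k * n)) Filter.atTop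
      (nhds 1) := by
  have h0 : Summable fun k : ℕ => q ^ k / qPoch q k := by simpa using qS_summable q hq0 hq1 0
  have := tendsto_tsum_of_dominated_convergence (𝓕 := Filter.atTop)
    (f := fun (n k : ℕ) => q ^ k / qPoch q k * q ^ (k * n))
    (g := fun k => if k = 0 then (1:ℝ) else 0) h0 (fun k => by
      split_ifs with h
      · subst h; simp [qPoch]
      · have t := tendsto_pow_atTop_nhds_zero_of_lt_one (pow_nonneg hq0.le k)
          (pow_lt_one₀ hq0.le hq1 h)
        simpa [pow_mul] using t.const_mul (q ^ k / qPoch q k))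
    (Filter.Eventually.of_forall fun n k => by
      have := qPoch_pos q hq0 hq1 k
      rw [Real.norm_of_nonneg (by positivity)]
      exact mul_le_of_le_one_right (by positivity) (pow_le_one₀ hq0.le hq1.le))
  simpa using this

lemma qProd_mul (q : ℝ) (hq0 : 0 < q) (hq1 : q < 1) :
    (∏' j : ℕ, (1 - (q : ℂ) ^ (j + 1))) * ((∑' k : ℕ, q ^ k / qPoch q k : ℝ) : ℂ) = 1 := by
  have hm : Multipliable fun j : ℕ => (1 - (q : ℂ) ^ (j + 1)) :=
    ModularForm.multipliable_one_sub_pow (by simpa [abs_of_pos hq0] using hq1)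
  have t1 := hm.hasProd.tendsto_prod_nat.mul_const ((∑' k : ℕ, q ^ k / qPoch q k : ℝ) : ℂ)
  have t2 := (Complex.continuous_ofReal.tendsto 1).comp (qS_limit q hq0 hq1)
  refine tendsto_nhds_unique t1 ?_
  simp only [Complex.ofReal_one] at t2
  refine t2.congr fun n => ?_
  simp only [Function.comp]
  rw [qS_eq q hq0 hq1, qPoch_range]
  push_cast
  rfl

lemma rk_sq (q : ℝ) (hq0 : 0 < q) (hq1 : q < 1) (k : ℕ) : rk q k ^ 2 = q ^ k / (1 - q) := by
  unfold rk
  rw [div_pow, Real.sq_sqrt (by linarith), ← Real.rpow_natCast, ← Real.rpow_mul hq0.le]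
  norm_num

lemma rk_pos (q : ℝ) (hq0 : 0 < q) (hq1 : q < 1) (k : ℕ) : 0 < rk q k :=
  div_pos (Real.rpow_pos_of_pos hq0 _) (Real.sqrt_pos.2 (by linarith))

lemma rk_lt (q : ℝ) (hq0 : 0 < q) (hq1 : q < 1) (k : ℕ) : rk q k < 1 / (1 - q) := by
  have h : 0 < 1 - q := by linarith
  refine lt_of_pow_lt_pow_left₀ 2 (by positivity) ?_
  rw [rk_sq q hq0 hq1, div_pow, one_pow, div_lt_div_iff₀ h (by positivity)]
  have : q ^ k ≤ 1 := pow_le_one₀ hq0.le hq1.le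
  nlinarith [mul_le_mul_of_nonneg_right this (sq_nonneg (1 - q))]


/-- The measure `dμ_q = (q;q)_∞ Σ_k (q^k/(q;q)_k) dλ_{r_k}` realizes the inner product of the
q-Fock space `H_{2,q}`: for power series `F = Σ f_n z^n`, `G = Σ g_n z^n` on the disk
`|z| < 1/(1−q)` with `Σ [n]_q! |f_n|² < ∞` and `Σ [n]_q! |g_n|² < ∞`, all the integrals and
series below converge absolutely and
`(q;q)_∞ Σ_k (q^k/(q;q)_k) (1/2π) ∫_0^{2π} F(r_k e^{iθ}) conj(G(r_k e^{iθ})) dθ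
  = Σ_n [n]_q! f_n conj(g_n)`. -/
theorem qFock_inner_product_measure (q : ℝ) (hq0 : 0 < q) (hq1 : q < 1)
    (f g : ℕ → ℂ) (F G : ℂ → ℂ)
    (hF : ∀ z : ℂ, ‖z‖ < 1 / (1 - q) → HasSum (fun n : ℕ => f n * z ^ n) (F z))
    (hG : ∀ z : ℂ, ‖z‖ < 1 / (1 - q) → HasSum (fun n : ℕ => g n * z ^ n) (G z))
    (hf : Summable fun n : ℕ => qFact q n * ‖f n‖ ^ 2)
    (hg : Summable fun n : ℕ => qFact q n * ‖g n‖ ^ 2) :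
    (∀ k : ℕ, IntervalIntegrable
        (fun θ : ℝ => F ((rk q k : ℂ) * Complex.exp (θ * Complex.I)) *
          (starRingEnd ℂ) (G ((rk q k : ℂ) * Complex.exp (θ * Complex.I))))
        volume 0 (2 * Real.pi)) ∧
    Summable (fun k : ℕ => (q ^ k / qPoch q k) *
      ‖(1 / (2 * Real.pi) : ℂ) * ∫ θ in (0 : ℝ)..(2 * Real.pi),
        F ((rk q k : ℂ) * Complex.exp (θ * Complex.I)) *
          (starRingEnd ℂ) (G ((rk q k : ℂ) * Complex.exp (θ * Complex.I)))‖) ∧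
    Summable (fun n : ℕ => ‖(qFact q n : ℂ) * f n * (starRingEnd ℂ) (g n)‖) ∧
    ((∏' j : ℕ, (1 - (q : ℂ) ^ (j + 1))) *
      ∑' k : ℕ, ((q : ℂ) ^ k / (qPoch q k : ℂ)) *
        ((1 / (2 * Real.pi) : ℂ) * ∫ θ in (0 : ℝ)..(2 * Real.pi),
          F ((rk q k : ℂ) * Complex.exp (θ * Complex.I)) *
            (starRingEnd ℂ) (G ((rk q k : ℂ) * Complex.exp (θ * Complex.I))))
      = ∑' n : ℕ, (qFact q n : ℂ) * f n * (starRingEnd ℂ) (g n)) := by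
  have hP : ∀ k, 0 < qPoch q k := qPoch_pos q hq0 hq1
  have h1q : 0 < 1 - q := by linarith
  -- absolute summability of the coefficients on each circle
  have hz : ∀ (k : ℕ) (θ : ℝ), ‖(rk q k : ℂ) * Complex.exp (θ * Complex.I)‖ < 1 / (1 - q) := by
    intro k θ
    rw [norm_mul, Complex.norm_exp_ofReal_mul_I, mul_one, Complex.norm_of_nonneg
      (rk_pos q hq0 hq1 k).le]
    exact rk_lt q hq0 hq1 k
  have hA : ∀ (h : ℕ → ℂ) (H : ℂ → ℂ),
      (∀ z : ℂ, ‖z‖ < 1 / (1 - q) → HasSum (fun n : ℕ => h n * z ^ n) (H z)) →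
      ∀ k : ℕ, (Summable fun n => ‖h n * (rk q k : ℂ) ^ n‖) ∧
        ∀ θ : ℝ, HasSum (fun n => h n * (rk q k : ℂ) ^ n * Complex.exp (θ * Complex.I) ^ n)
          (H ((rk q k : ℂ) * Complex.exp (θ * Complex.I))) := by
    intro h H hH k
    constructor
    · have := (hH _ (hz k 0)).summable.norm
      simpa using this
    · intro θ
      have := hH _ (hz k θ)
      simpa only [mul_pow, mul_assoc] using this
  have hcirc : ∀ k : ℕ, HasSum
      (fun n => ((q ^ (k * n) / (1 - q) ^ n : ℝ) : ℂ) * (f n * (starRingEnd ℂ) (g n)))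
      ((1 / (2 * Real.pi) : ℂ) * ∫ θ in (0 : ℝ)..(2 * Real.pi),
        F ((rk q k : ℂ) * Complex.exp (θ * Complex.I)) *
          (starRingEnd ℂ) (G ((rk q k : ℂ) * Complex.exp (θ * Complex.I)))) := by
    intro k
    have := aux_circle _ _ (hA f F hF k).1 (hA g G hG k).1 _ _ (hA f F hF k).2 (hA g G hG k).2
    refine hs_complex this (fun n => ?_) rfl
    have e : q ^ (k * n) / (1 - q) ^ n = rk q k ^ n * rk q k ^ n := by
      rw [← mul_pow, ← sq, rk_sq q hq0 hq1, div_pow, pow_mul]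
    rw [e]
    simp only [map_mul, map_pow, Complex.conj_ofReal]
    push_cast
    ring
  -- summability of the right-hand side
  have hfact : ∀ n, 0 < qFact q n := fun n => by
    rw [qFact_eq q hq1]; exact div_pos (hP n) (pow_pos h1q n)
  have hR : Summable (fun n : ℕ => ‖(qFact q n : ℂ) * f n * (starRingEnd ℂ) (g n)‖) := by
    refine Summable.of_nonneg_of_le (fun n => norm_nonneg _) (fun n => ?_) (hf.add hg)
    rw [norm_mul, norm_mul, RCLike.norm_conj, Complex.norm_of_nonneg (hfact n).le]
    have := hfact n
    nlinarith [mul_nonneg this.le (sq_nonneg (‖f n‖ - ‖g n‖)),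
      mul_nonneg this.le (sq_nonneg ‖f n‖), mul_nonneg this.le (sq_nonneg ‖g n‖)]
  -- the double series
  set S : ℝ := ∑' k : ℕ, q ^ k / qPoch q k with hS
  have hsumk : ∀ n : ℕ, HasSum (fun k : ℕ => q ^ k / qPoch q k * (q ^ (k * n) / (1 - q) ^ n))
      (S * qFact q n) := by
    intro n
    have := (qS_summable q hq0 hq1 n).hasSum.div_const ((1 - q) ^ n)
    rw [qS_eq q hq0 hq1 n] at this
    rw [qFact_eq q hq1]
    refine hs_real this (fun k => ?_) ?_
    · ring
    · rw [hS]; ring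
  let D : ℕ × ℕ → ℂ := fun p => ((q ^ p.2 / qPoch q p.2 * (q ^ (p.2 * p.1) / (1 - q) ^ p.1) : ℝ) : ℂ)
    * (f p.1 * (starRingEnd ℂ) (g p.1))
  have hDn : ∀ n k, ‖D (n, k)‖ = q ^ k / qPoch q k * (q ^ (k * n) / (1 - q) ^ n) *
      ‖f n * (starRingEnd ℂ) (g n)‖ := by
    intro n k
    have := hP k
    simp only [D]
    rw [norm_mul, Complex.norm_of_nonneg (by positivity)]
  have hDnorm : Summable fun p => ‖D p‖ := by
    rw [summable_prod_of_nonneg (fun p => norm_nonneg _)]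
    simp_rw [hDn]
    refine ⟨fun n => (hsumk n).summable.mul_right _, ?_⟩
    simp_rw [tsum_mul_right, (hsumk _).tsum_eq]
    refine (hR.mul_left S).congr fun n => ?_
    rw [mul_assoc, norm_mul, Complex.norm_of_nonneg (hfact n).le]
    ring
  have hD : Summable D := hDnorm.of_norm
  have hDk : ∀ n, HasSum (fun k => D (n, k)) ((S : ℂ) *
      ((qFact q n : ℂ) * f n * (starRingEnd ℂ) (g n))) := by
    intro n
    have := (Complex.hasSum_ofReal.2 (hsumk n)).mul_right (f n * (starRingEnd ℂ) (g n))
    refine hs_complex this (fun k => rfl) ?_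
    push_cast; ring
  have hDs : ∀ k, HasSum (fun n => D (n, k)) (((q : ℂ) ^ k / (qPoch q k : ℂ)) *
      ((1 / (2 * Real.pi) : ℂ) * ∫ θ in (0 : ℝ)..(2 * Real.pi),
        F ((rk q k : ℂ) * Complex.exp (θ * Complex.I)) *
          (starRingEnd ℂ) (G ((rk q k : ℂ) * Complex.exp (θ * Complex.I))))) := by
    intro k
    have := (hcirc k).mul_left ((q : ℂ) ^ k / (qPoch q k : ℂ))
    refine hs_complex this (fun n => ?_) rfl
    simp only [D]
    push_cast; ring
  refine ⟨fun k => ?_, ?_, hR, ?_⟩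
  · refine Continuous.intervalIntegrable ?_ _ _
    have c1 := aux_cont _ (hA f F hF k).1 _ (hA f F hF k).2
    have c2 := aux_cont _ (hA g G hG k).1 _ (hA g G hG k).2
    exact c1.mul (Complex.continuous_conj.comp c2)
  · have h1 := hDnorm.prod_symm
    have h2 := ((summable_prod_of_nonneg (fun p => norm_nonneg _)).1 h1).2
    have h3 := fun k => ((summable_prod_of_nonneg (fun p => norm_nonneg _)).1 h1).1 k
    refine Summable.of_nonneg_of_le (fun k => ?_) (fun k => ?_) h2
    · have := hP k; positivity
    · have e := norm_tsum_le_tsum_norm (h3 k)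
      simp only [Prod.swap_prod_mk] at e ⊢
      rw [(hDs k).tsum_eq, norm_mul] at e
      refine le_trans (le_of_eq ?_) e
      congr 1
      rw [norm_div, norm_pow, Complex.norm_of_nonneg hq0.le, Complex.norm_of_nonneg (hP k).le]
  · have h1 := Summable.tsum_comm (f := fun n k => D (n, k)) hD
    simp_rw [(hDk _).tsum_eq, (hDs _).tsum_eq] at h1
    rw [h1, tsum_mul_left, ← mul_assoc, hS, qProd_mul q hq0 hq1, one_mul]
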